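/- Let q be an odd prime power with q ≡ 3 (mod 4), q > 7, and d = (q-3)/2. Suppose 5 is a nonzero square in F_q, and let λ = ∑_{x∈F_q} χ(x(x²+4x-1)) + ∑_{x∈F_q} χ(x(x²-2x+5)). For i ∈ {0,1,2,3}, let ω_i = |{b ∈ F_q : |{x ∈ F_q : (x+1)^d - x^d = b}| = i}|. Then ω₀ = (q + λ + 1)/4, ω₁ = (q - λ + 3)/2, ω₂ = (q + λ - 15)/4, and ω₃ = 2. -/

import Mathlib

open Finset

section QuadraticCharacter

variable {F : Type*} [Field F] [Fintype F] [DecidableEq F]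

lemma quadraticChar_neg_eq_neg (hm : quadraticChar F (-1) = -1) (x : F) :
    quadraticChar F (-x) = -quadraticChar F x := by
  rw [← neg_one_mul, map_mul, hm, neg_one_mul]

lemma quadraticChar_ne_zero_of_eq_neg_one {x : F} (h : quadraticChar F x = -1) : x ≠ 0 := by
  rintro rfl
  simp at h

lemma quadraticChar_ne_zero_of_eq_one {x : F} (h : quadraticChar F x = 1) : x ≠ 0 := by
  rintro rfl
  simp at h

lemma exists_sq_of_quadraticChar_eq_one {a : F} (h : quadraticChar F a = 1) :
    ∃ s, s ^ 2 = a ∧ s ≠ 0 := by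
  have ha := quadraticChar_ne_zero_of_eq_one h
  obtain ⟨s, rfl⟩ := (quadraticChar_one_iff_isSquare ha).1 h
  exact ⟨s, sq s, by rintro rfl; simp at ha⟩

lemma quadraticChar_eq_one_of_sq {a s : F} (h : s ^ 2 = a) (ha : a ≠ 0) :
    quadraticChar F a = 1 :=
  (quadraticChar_one_iff_isSquare ha).2 ⟨s, by rw [← h, sq]⟩

lemma sq_add_four_ne_zero (hm : quadraticChar F (-1) = -1) (h2 : (2 : F) ≠ 0) (b : F) :
    b ^ 2 + 4 ≠ 0 := by
  intro h
  refine quadraticChar_neg_one_iff_not_isSquare.1 hm ⟨b / 2, ?_⟩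
  field_simp
  linear_combination -h

/-- The preimages of `b` under `x ↦ (x + 1) ^ d - x ^ d` with `x` and `x + 1` both nonsquares. -/
def IsNonsquareSol (b x : F) : Prop :=
  quadraticChar F x = -1 ∧ quadraticChar F (x + 1) = -1 ∧ b * x * (x + 1) = 1

/-- The preimages of `b` under `x ↦ (x + 1) ^ d - x ^ d` with exactly one of `x` and `x + 1` a
nonzero square and the other a nonsquare. -/
def IsMixedSol (b x : F) : Prop :=
  (quadraticChar F x = -1 ∧ quadraticChar F (x + 1) = 1 ∧ b * x * (x + 1) = 2 * x + 1) ∨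
    (quadraticChar F x = 1 ∧ quadraticChar F (x + 1) = -1 ∧ b * x * (x + 1) = -(2 * x + 1))

lemma pow_mul_self_eq_quadraticChar (hF : ringChar F ≠ 2) {d : ℕ}
    (hd : d + 1 = Fintype.card F / 2) (x : F) : x ^ d * x = (quadraticChar F x : F) := by
  rw [quadraticChar_eq_pow_of_char_ne_two' hF, ← hd, pow_succ]

lemma pow_sub_pow_eq_iff (hF : ringChar F ≠ 2) (hm : quadraticChar F (-1) = -1) {d : ℕ}
    (hd : d + 1 = Fintype.card F / 2) (hd0 : d ≠ 0) {b : F} (hb : quadraticChar F b = 1) (x : F) :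
    (x + 1) ^ d - x ^ d = b ↔ (x = 0 ∧ b = 1) ∨ IsNonsquareSol b x ∨ IsMixedSol b x := by
  have hx := pow_mul_self_eq_quadraticChar hF hd x
  have hx1 := pow_mul_self_eq_quadraticChar hF hd (x + 1)
  unfold IsNonsquareSol IsMixedSol
  rcases eq_or_ne x 0 with rfl | h0
  · simp [hd0, eq_comm]
  rcases eq_or_ne (x + 1) 0 with h1 | h1
  · obtain rfl : x = -1 := eq_neg_of_add_eq_zero_left h1
    have hneg := pow_mul_self_eq_quadraticChar hF hd (-1 : F)
    rw [hm] at hneg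
    have hpow : (-1 : F) ^ d = 1 := by
      push_cast at hneg
      linear_combination -hneg
    simp only [h1, zero_pow hd0, hpow]
    constructor
    · rintro rfl
      simp [hm] at hb
    · simp
  have key : (x + 1) ^ d - x ^ d = b ↔
      b * x * (x + 1) = (quadraticChar F (x + 1) : F) * x - (quadraticChar F x : F) * (x + 1) := by
    rw [← hx, ← hx1]
    constructor
    · rintro rfl
      ring
    · intro h
      apply mul_right_cancel₀ (mul_ne_zero h0 h1)
      linear_combination -h
  rw [key]
  rcases quadraticChar_dichotomy h0 with hc | hc <;>
    rcases quadraticChar_dichotomy h1 with hc1 | hc1 <;> simp [hc, hc1, h0]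
  · intro h
    have := congrArg (quadraticChar F) h
    simp only [map_mul, hc, hc1, hb, hm] at this
    norm_num at this
  · constructor <;> intro h <;> linear_combination h
  · constructor <;> intro h <;> linear_combination h

lemma IsNonsquareSol.eq (hm : quadraticChar F (-1) = -1) {b x y : F}
    (hb : quadraticChar F b = 1) (hx : IsNonsquareSol b x) (hy : IsNonsquareSol b y) : x = y := by
  obtain ⟨hx0, hx1, hx⟩ := hx
  obtain ⟨hy0, hy1, hy⟩ := hy
  have hb0 := quadraticChar_ne_zero_of_eq_one hb
  have h : (x - y) * (x + y + 1) = 0 := by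
    apply mul_left_cancel₀ hb0
    linear_combination hx - hy
  rcases mul_eq_zero.1 h with h | h
  · exact sub_eq_zero.1 h
  · have hxy : y = -(x + 1) := by linear_combination h
    rw [hxy, quadraticChar_neg_eq_neg hm, hx1] at hy0
    norm_num at hy0

lemma exists_isNonsquareSol_iff (hm : quadraticChar F (-1) = -1) (h2 : (2 : F) ≠ 0) {b : F}
    (hb : quadraticChar F b = 1) :
    (∃ x, IsNonsquareSol b x) ↔ quadraticChar F (b + 4) = 1 := by
  have hb0 := quadraticChar_ne_zero_of_eq_one hb
  constructor
  · rintro ⟨x, -, -, hx⟩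
    have h4 : b + 4 ≠ 0 := by
      intro h
      have h4 : quadraticChar F 4 = 1 :=
        quadraticChar_eq_one_of_sq (s := 2) (by norm_num) (by
          rw [show (4 : F) = 2 * 2 by norm_num]; exact mul_ne_zero h2 h2)
      rw [eq_neg_of_add_eq_zero_left h, quadraticChar_neg_eq_neg hm, h4] at hb
      norm_num at hb
    have h := quadraticChar_eq_one_of_sq (a := b * (b + 4)) (s := 2 * b * x + b)
      (by linear_combination 4 * b * hx) (mul_ne_zero hb0 h4)
    rwa [map_mul, hb, one_mul] at h
  · intro h
    obtain ⟨s, hs, -⟩ := exists_sq_of_quadraticChar_eq_one h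
    obtain ⟨c, hc, hc0⟩ := exists_sq_of_quadraticChar_eq_one hb
    obtain ⟨x, hx⟩ : ∃ x, x = (s - c) / (2 * c) := ⟨_, rfl⟩
    have hsol : b * x * (x + 1) = 1 := by
      rw [hx, ← hc]
      field_simp
      linear_combination hs - hc
    have hprod := congrArg (quadraticChar F) hsol
    rw [map_mul, map_mul, hb, one_mul, map_one] at hprod
    have h0 : x ≠ 0 := by rintro rfl; simp at hsol
    rcases quadraticChar_dichotomy h0 with h | h
    · refine ⟨-(x + 1), ?_, ?_, by linear_combination hsol⟩
      · rw [quadraticChar_neg_eq_neg hm]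
        simpa [h] using hprod
      · rw [show -(x + 1) + 1 = -x by ring, quadraticChar_neg_eq_neg hm, h]
    · refine ⟨x, h, ?_, hsol⟩
      rw [h] at hprod
      linarith

lemma IsMixedSol.eq (hm : quadraticChar F (-1) = -1) (h2 : (2 : F) ≠ 0) {b x y : F}
    (hb : quadraticChar F b = 1) (hx : IsMixedSol b x) (hy : IsMixedSol b y) : x = y := by
  have hb0 := quadraticChar_ne_zero_of_eq_one hb
  have mixed : ∀ x y : F, quadraticChar F (x + 1) = 1 → b * x * (x + 1) = 2 * x + 1 →
      quadraticChar F y = 1 → b * y * (y + 1) = -(2 * y + 1) → False := by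
    intro x y hx1 hx hy0 hy
    have h : (2 * 2) * b * ((y + x + 1) * (b * (x - y) - 2)) = 0 := by
      linear_combination (2 * 2) * b * (hx - hy)
    rcases mul_eq_zero.1 ((mul_eq_zero.1 h).resolve_left
      (mul_ne_zero (mul_ne_zero h2 h2) hb0)) with h | h
    · rw [show y = -(x + 1) by linear_combination h, quadraticChar_neg_eq_neg hm, hx1] at hy0
      norm_num at hy0
    · have hp : b * (y * (x + 1)) = -1 := by linear_combination hx - (x + 1) * h
      have := congrArg (quadraticChar F) hp
      simp only [map_mul, hb, hy0, hx1, hm] at this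
      norm_num at this
  rcases hx with ⟨hx0, hx1, hx⟩ | ⟨hx0, hx1, hx⟩ <;> rcases hy with ⟨hy0, hy1, hy⟩ | ⟨hy0, hy1, hy⟩
  · by_contra hne
    have h : b * (x + y + 1) = 2 := by
      apply mul_left_cancel₀ (sub_ne_zero.2 hne)
      linear_combination hx - hy
    have hp : b * (x * y) = -1 := by linear_combination x * h - hx
    have := congrArg (quadraticChar F) hp
    simp only [map_mul, hb, hx0, hy0, hm] at this
    norm_num at this
  · exact (mixed x y hx1 hx hy0 hy).elim
  · exact (mixed y x hy1 hy hx0 hx).elim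
  · by_contra hne
    have h : b * (x + y + 1) = -2 := by
      apply mul_left_cancel₀ (sub_ne_zero.2 hne)
      linear_combination hx - hy
    have hp : b * ((x + 1) * (y + 1)) = -1 := by
      linear_combination (x + 1) * h - hx
    have := congrArg (quadraticChar F) hp
    simp only [map_mul, hb, hx1, hy1, hm] at this
    norm_num at this

lemma exists_isMixedSol_iff (hm : quadraticChar F (-1) = -1) (h2 : (2 : F) ≠ 0) {b : F}
    (hb : quadraticChar F b = 1) :
    (∃ x, IsMixedSol b x) ↔ quadraticChar F (b ^ 2 + 4) = 1 := by
  have hb0 := quadraticChar_ne_zero_of_eq_one hb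
  constructor
  · rintro ⟨x, ⟨-, -, hx⟩ | ⟨-, -, hx⟩⟩
    · exact quadraticChar_eq_one_of_sq (s := 2 * b * x + b - 2)
        (by linear_combination 4 * b * hx) (sq_add_four_ne_zero hm h2 b)
    · exact quadraticChar_eq_one_of_sq (s := 2 * b * x + b + 2)
        (by linear_combination 4 * b * hx) (sq_add_four_ne_zero hm h2 b)
  · intro h
    obtain ⟨s, hs, -⟩ := exists_sq_of_quadraticChar_eq_one h
    obtain ⟨x, hx⟩ : ∃ x, x = (2 - b + s) / (2 * b) := ⟨_, rfl⟩
    obtain ⟨y, hy⟩ : ∃ y, y = (2 - b - s) / (2 * b) := ⟨_, rfl⟩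
    have hsolx : b * x * (x + 1) = 2 * x + 1 := by
      rw [hx]
      field_simp
      linear_combination hs
    have hsoly : b * y * (y + 1) = 2 * y + 1 := by
      rw [hy]
      field_simp
      linear_combination hs
    have hxy : b * x * y = -1 := by
      rw [hx, hy]
      field_simp
      linear_combination -hs
    have hxy1 : b * (x + 1) * (y + 1) = 1 := by
      rw [hx, hy]
      field_simp
      linear_combination -hs
    have p := congrArg (quadraticChar F) hxy
    have p1 := congrArg (quadraticChar F) hxy1
    simp only [map_mul, hb, one_mul, map_one, hm] at p p1
    clear hx hy
    have h0 : x ≠ 0 := by rintro rfl; simp at hxy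
    have h1 : x + 1 ≠ 0 := by intro h; simp [h] at hxy1
    have nonsquare_square : ∀ z : F, b * z * (z + 1) = 2 * z + 1 → quadraticChar F z = -1 →
        quadraticChar F (z + 1) = 1 → ∃ x, IsMixedSol b x :=
      fun z hz hz0 hz1 => ⟨z, .inl ⟨hz0, hz1, hz⟩⟩
    have square_nonsquare : ∀ z : F, b * z * (z + 1) = 2 * z + 1 → quadraticChar F z = 1 →
        quadraticChar F (z + 1) = -1 → ∃ x, IsMixedSol b x := by
      refine fun z hz hz0 hz1 => ⟨-(z + 1), .inr ⟨?_, ?_, by linear_combination hz⟩⟩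
      · rw [quadraticChar_neg_eq_neg hm, hz1, neg_neg]
      · rw [show -(z + 1) + 1 = -z by ring, quadraticChar_neg_eq_neg hm, hz0]
    rcases quadraticChar_dichotomy h0 with hx0 | hx0 <;>
      rcases quadraticChar_dichotomy h1 with hx1 | hx1 <;> rw [hx0] at p <;> rw [hx1] at p1
    · exact nonsquare_square y hsoly (by linarith) (by linarith)
    · exact square_nonsquare x hsolx hx0 hx1
    · exact nonsquare_square x hsolx hx0 hx1
    · exact square_nonsquare y hsoly (by linarith) (by linarith)

/-- The number of preimages of `b` under `x ↦ (x + 1) ^ d - x ^ d`. -/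
def diffCount (F : Type*) [Field F] [Fintype F] [DecidableEq F] (d : ℕ) (b : F) : ℕ :=
  #{x : F | (x + 1) ^ d - x ^ d = b}

lemma sum_diffCount (d : ℕ) : ∑ b : F, diffCount F d b = Fintype.card F := by
  rw [← card_univ]
  exact (card_eq_sum_card_fiberwise (f := fun x : F => (x + 1) ^ d - x ^ d)
    (fun _ _ => mem_coe.2 (mem_univ _))).symm

lemma card_filter_eq_ite_of_unique {α : Type*} [Fintype α] (P : α → Prop) [DecidablePred P]
    [Decidable (∃ x, P x)] (h : ∀ x y, P x → P y → x = y) :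
    #{x | P x} = if ∃ x, P x then 1 else 0 := by
  split_ifs with hex
  · obtain ⟨x, hx⟩ := hex
    refine card_eq_one.2 ⟨x, ?_⟩
    ext y
    simp only [mem_filter, mem_univ, true_and, mem_singleton]
    exact ⟨fun hy => h y x hy hx, by rintro rfl; exact hx⟩
  · simpa [filter_eq_empty_iff] using hex

lemma diffCount_eq (hF : ringChar F ≠ 2) (hm : quadraticChar F (-1) = -1) (h2 : (2 : F) ≠ 0)
    {d : ℕ} (hd : d + 1 = Fintype.card F / 2) (hd0 : d ≠ 0) {b : F}
    (hb : quadraticChar F b = 1) :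
    diffCount F d b = (if b = 1 then 1 else 0) + ((if quadraticChar F (b + 4) = 1 then 1 else 0) +
      if quadraticChar F (b ^ 2 + 4) = 1 then 1 else 0) := by
  classical
  have hdisj : Disjoint ({x : F | IsNonsquareSol b x} : Finset F)
      ({x : F | IsMixedSol b x} : Finset F) := by
    refine disjoint_filter.2 fun x _ h h' => ?_
    obtain ⟨h0, h1, -⟩ := h
    rcases h' with ⟨h0', h1', -⟩ | ⟨h0', h1', -⟩ <;> omega
  have hdisj0 : Disjoint ({x : F | x = 0 ∧ b = 1} : Finset F)
      ({x : F | IsNonsquareSol b x ∨ IsMixedSol b x} : Finset F) := by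
    refine disjoint_filter.2 fun x _ h h' => ?_
    obtain ⟨rfl, -⟩ := h
    simp [IsNonsquareSol, IsMixedSol] at h'
  have hone : #{x : F | x = 0 ∧ b = 1} = if b = 1 then 1 else 0 := by
    split_ifs with h <;> simp [h, filter_eq']
  unfold diffCount
  simp only [pow_sub_pow_eq_iff hF hm hd hd0 hb]
  rw [filter_or, card_union_of_disjoint hdisj0, filter_or, card_union_of_disjoint hdisj, hone,
    card_filter_eq_ite_of_unique _ fun x y hx hy => hx.eq hm hb hy,
    card_filter_eq_ite_of_unique _ fun x y hx hy => hx.eq hm h2 hb hy]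
  simp only [exists_isNonsquareSol_iff hm h2 hb, exists_isMixedSol_iff hm h2 hb]

lemma diffCount_neg {d : ℕ} (hd : Even d) (b : F) : diffCount F d (-b) = diffCount F d b := by
  refine card_nbij' (fun x => -(x + 1)) (fun x => -(x + 1)) ?_ ?_ ?_ ?_
  · intro x hx
    simp only [coe_filter, mem_univ, true_and, Set.mem_ofPred_eq] at hx ⊢
    rw [show -(x + 1) + 1 = -x by ring, hd.neg_pow, hd.neg_pow]
    linear_combination -hx
  · intro x hx
    simp only [coe_filter, mem_univ, true_and, Set.mem_ofPred_eq] at hx ⊢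
    rw [show -(x + 1) + 1 = -x by ring, hd.neg_pow, hd.neg_pow]
    linear_combination -hx
  · intro x _
    ring
  · intro x _
    ring

lemma diffCount_zero (hF : ringChar F ≠ 2) (h2 : (2 : F) ≠ 0) {d : ℕ}
    (hd : d + 1 = Fintype.card F / 2) (hd0 : d ≠ 0) (hde : Even d) : diffCount F d 0 = 1 := by
  refine card_eq_one.2 ⟨-1 / 2, ?_⟩
  ext x
  simp only [mem_filter, mem_univ, true_and, mem_singleton]
  constructor
  · intro h
    have hx := pow_mul_self_eq_quadraticChar hF hd x
    have hx1 := pow_mul_self_eq_quadraticChar hF hd (x + 1)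
    have h0 : x ≠ 0 := by rintro rfl; simp [hd0] at h
    have h1 : x + 1 ≠ 0 := by
      intro h1
      rw [h1, zero_pow hd0, zero_sub, neg_eq_zero] at h
      exact h0 (pow_eq_zero_iff hd0 |>.1 h)
    have key : (quadraticChar F (x + 1) : F) * x = (quadraticChar F x : F) * (x + 1) := by
      rw [← hx, ← hx1]
      linear_combination x * (x + 1) * h
    rcases quadraticChar_dichotomy h0 with hc | hc <;>
      rcases quadraticChar_dichotomy h1 with hc1 | hc1 <;>
      rw [hc, hc1] at key <;> push_cast at key
    · exact (one_ne_zero (α := F) (by linear_combination -key)).elim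
    · field_simp
      linear_combination -key
    · field_simp
      linear_combination key
    · exact (one_ne_zero (α := F) (by linear_combination key)).elim
  · rintro rfl
    rw [show (-1 / 2 + 1 : F) = -(-1 / 2) by field_simp; norm_num, hde.neg_pow, sub_self]

lemma card_sub_inv_eq (hF : ringChar F ≠ 2) (h2 : (2 : F) ≠ 0) (t : F) :
    (#{x : F | x ≠ 0 ∧ x - x⁻¹ = t} : ℤ) = 1 + quadraticChar F (t ^ 2 + 4) := by
  rw [add_comm, ← quadraticChar_card_sqrts hF]
  congr 1
  refine card_nbij' (fun x => 2 * x - t) (fun s => (s + t) / 2) ?_ ?_ ?_ ?_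
  · intro x hx
    simp only [coe_filter, mem_univ, true_and, Set.mem_ofPred_eq, Set.coe_toFinset] at hx ⊢
    obtain ⟨h0, rfl⟩ := hx
    field_simp
    ring
  · intro s hs
    simp only [coe_filter, mem_univ, true_and, Set.mem_ofPred_eq, Set.coe_toFinset] at hs ⊢
    have h4 : (2 * 2 : F) ≠ 0 := mul_ne_zero h2 h2
    have h0 : s + t ≠ 0 := by
      intro h
      apply h4
      linear_combination (s - t) * h - hs
    refine ⟨div_ne_zero h0 h2, ?_⟩
    field_simp
    linear_combination hs
  · intro x _
    field_simp
    ring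
  · intro s _
    field_simp
    ring

/-- Substituting `t = x - x⁻¹` in a sum over the field. -/
lemma sum_mul_one_add_quadraticChar (hF : ringChar F ≠ 2) (h2 : (2 : F) ≠ 0) (g : F → ℤ) :
    ∑ t, g t * (1 + quadraticChar F (t ^ 2 + 4)) = ∑ x : F with x ≠ 0, g (x - x⁻¹) := by
  rw [← sum_fiberwise (univ.filter fun x : F => x ≠ 0) (fun x => x - x⁻¹)]
  refine sum_congr rfl fun t _ => ?_
  rw [filter_filter, ← card_sub_inv_eq hF h2 t,
    sum_congr rfl fun x hx => by rw [(mem_filter.1 hx).2.2], sum_const, nsmul_eq_mul, mul_comm]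

lemma sum_quadraticChar_sq_add_four (hF : ringChar F ≠ 2) (h2 : (2 : F) ≠ 0) :
    ∑ t : F, quadraticChar F (t ^ 2 + 4) = -1 := by
  have h := sum_mul_one_add_quadraticChar hF h2 fun _ => 1
  simp only [one_mul, sum_add_distrib, filter_ne', sum_const, card_univ,
    card_erase_of_mem (mem_univ (0 : F)), nsmul_eq_mul, mul_one,
    Nat.cast_sub Fintype.card_pos] at h
  push_cast at h
  linarith

lemma sum_quadraticChar_add (hF : ringChar F ≠ 2) (a : F) :
    ∑ t : F, quadraticChar F (t + a) = 0 := by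
  rw [← quadraticChar_sum_zero hF]
  exact Equiv.sum_comp (Equiv.addRight a) (fun t => quadraticChar F t)

lemma quadraticChar_sq_mul {c : F} (hc : c ≠ 0) (a : F) :
    quadraticChar F (c ^ 2 * a) = quadraticChar F a := by
  rw [map_mul, quadraticChar_sq_one' hc, one_mul]

lemma sum_quadraticChar_add_four_mul (hF : ringChar F ≠ 2) (h2 : (2 : F) ≠ 0) :
    ∑ t : F, quadraticChar F ((t + 4) * (t ^ 2 + 4)) =
      ∑ x : F, quadraticChar F (x * (x ^ 2 + 4 * x - 1)) := by
  have h := sum_mul_one_add_quadraticChar hF h2 fun t => quadraticChar F (t + 4)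
  simp only [mul_add, mul_one, sum_add_distrib, sum_quadraticChar_add hF, zero_add,
    ← map_mul] at h
  simp only [mul_add, map_mul] at h ⊢
  rw [h, sum_filter]
  refine sum_congr rfl fun x _ => ?_
  split_ifs with h0
  · rw [← quadraticChar_sq_mul h0, ← map_mul]
    congr 1
    field_simp
    ring
  · simp [not_not.1 h0]

/-- Substituting `t = x⁻¹` in a sum over the nonzero elements. -/
lemma sum_inv_eq_sum_sub (g : F → ℤ) :
    ∑ x : F, (if x = 0 then 0 else g x⁻¹) = ∑ x, g x - g 0 := by
  rw [← Equiv.sum_comp (Equiv.inv F) fun x => if x = 0 then 0 else g x⁻¹]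
  simp only [Equiv.inv_apply, inv_eq_zero, inv_inv]
  rw [← sum_erase_eq_sub (mem_univ 0), ← filter_ne', sum_filter]
  simp

lemma sum_quadraticChar_mul_add_four (hF : ringChar F ≠ 2) (h2 : (2 : F) ≠ 0) :
    ∑ t : F, quadraticChar F (t * (t + 4)) = -1 := by
  have h4 : (2 ^ 2 : F) ≠ 0 := pow_ne_zero 2 h2
  have h := sum_inv_eq_sum_sub fun x : F => quadraticChar F (1 + 4 * x)
  have hlin : ∑ x : F, quadraticChar F (1 + 4 * x) = 0 := by
    rw [← quadraticChar_sum_zero hF]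
    refine Fintype.sum_equiv ((Equiv.mulLeft₀ _ h4).trans (Equiv.addLeft 1)) _ _ fun x => ?_
    change _ = quadraticChar F (1 + 2 ^ 2 * x)
    norm_num
  rw [hlin, mul_zero, add_zero, map_one, zero_sub] at h
  rw [← h]
  refine sum_congr rfl fun t _ => ?_
  split_ifs with h0
  · simp [h0]
  · rw [← quadraticChar_sq_mul h0 (1 + 4 * t⁻¹)]
    congr 1
    field_simp

lemma sum_quadraticChar_quartic (h2 : (2 : F) ≠ 0) :
    ∑ t : F, quadraticChar F (t * (t + 4) * (t ^ 2 + 4)) =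
      ∑ x : F, quadraticChar F (x * (x ^ 2 - 2 * x + 5)) - 1 := by
  have h4 : (2 ^ 2 : F) ≠ 0 := pow_ne_zero 2 h2
  have h := sum_inv_eq_sum_sub fun x : F => quadraticChar F ((1 + 4 * x) * (1 + 4 * x ^ 2))
  have hlin : ∑ x : F, quadraticChar F ((1 + 4 * x) * (1 + 4 * x ^ 2)) =
      ∑ x : F, quadraticChar F (x * (x ^ 2 - 2 * x + 5)) := by
    refine Fintype.sum_equiv ((Equiv.mulLeft₀ _ h4).trans (Equiv.addLeft 1)) _ _ fun x => ?_
    change _ = quadraticChar F ((1 + 2 ^ 2 * x) * ((1 + 2 ^ 2 * x) ^ 2 - 2 * (1 + 2 ^ 2 * x) + 5))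
    rw [← quadraticChar_sq_mul h2]
    congr 1
    ring
  rw [hlin, mul_zero, zero_pow two_ne_zero, mul_zero, add_zero, mul_one, map_one] at h
  rw [← h]
  refine sum_congr rfl fun t _ => ?_
  split_ifs with h0
  · simp [h0]
  · rw [← quadraticChar_sq_mul (pow_ne_zero 2 h0) ((1 + 4 * t⁻¹) * _)]
    congr 1
    field_simp

lemma sum_quadraticChar_odd_cubic (hm : quadraticChar F (-1) = -1) :
    ∑ t : F, quadraticChar F (t * (t ^ 2 + 4)) = 0 := by
  have h := Equiv.sum_comp (Equiv.neg F) fun t => quadraticChar F (t * (t ^ 2 + 4))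
  simp only [Equiv.neg_apply, neg_sq, neg_mul, quadraticChar_neg_eq_neg hm,
    sum_neg_distrib] at h
  linarith

/-- Eight times the indicator of `b` being a nonzero square without preimages. -/
def zeroWeight (b : F) : ℤ :=
  (1 + quadraticChar F b) * (1 - quadraticChar F (b + 4)) * (1 - quadraticChar F (b ^ 2 + 4))

lemma sum_zeroWeight (hF : ringChar F ≠ 2) (hm : quadraticChar F (-1) = -1) (h2 : (2 : F) ≠ 0) :
    ∑ b : F, zeroWeight b = Fintype.card F +
      (∑ x : F, quadraticChar F (x * (x ^ 2 + 4 * x - 1)) +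
        ∑ x : F, quadraticChar F (x * (x ^ 2 - 2 * x + 5))) + 1 := by
  have hexp : ∀ b : F, zeroWeight b = 1 + quadraticChar F b - quadraticChar F (b + 4)
      - quadraticChar F (b ^ 2 + 4) - quadraticChar F (b * (b + 4))
      - quadraticChar F (b * (b ^ 2 + 4)) + quadraticChar F ((b + 4) * (b ^ 2 + 4))
      + quadraticChar F (b * (b + 4) * (b ^ 2 + 4)) := by
    intro b
    simp only [zeroWeight, map_mul]
    ring
  simp only [hexp, sum_add_distrib, sum_sub_distrib, quadraticChar_sum_zero hF,
    sum_quadraticChar_add hF, sum_quadraticChar_sq_add_four hF h2,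
    sum_quadraticChar_mul_add_four hF h2, sum_quadraticChar_odd_cubic hm,
    sum_quadraticChar_add_four_mul hF h2, sum_quadraticChar_quartic h2]
  simp only [sum_const, card_univ, nsmul_eq_mul, mul_one]
  ring

lemma eight_mul_ite_diffCount (hF : ringChar F ≠ 2) (hm : quadraticChar F (-1) = -1)
    (h2 : (2 : F) ≠ 0) {d : ℕ} (hd : d + 1 = Fintype.card F / 2) (hd0 : d ≠ 0) (hde : Even d)
    (h5 : quadraticChar F 5 = 1) (b : F) :
    8 * (if diffCount F d b = 0 then 1 else 0 : ℤ) = zeroWeight b + zeroWeight (-b) := by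
  have h4 : quadraticChar F 4 = 1 := by
    rw [show (4 : F) = 2 ^ 2 by norm_num]
    exact quadraticChar_sq_one' h2
  have square : ∀ b : F, quadraticChar F b = 1 →
      8 * (if diffCount F d b = 0 then 1 else 0 : ℤ) = zeroWeight b + zeroWeight (-b) := by
    intro b hb
    have hb4 : b + 4 ≠ 0 := by
      intro h
      rw [eq_neg_of_add_eq_zero_left h, quadraticChar_neg_eq_neg hm, h4] at hb
      norm_num at hb
    rw [diffCount_eq hF hm h2 hd hd0 hb]
    unfold zeroWeight
    rw [quadraticChar_neg_eq_neg hm, hb]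
    by_cases h1 : b = 1
    · subst h1
      norm_num [h5]
    · rcases quadraticChar_dichotomy hb4 with h | h <;>
        rcases quadraticChar_dichotomy (sq_add_four_ne_zero hm h2 b) with h' | h' <;>
        simp [h, h', h1]
  rcases eq_or_ne b 0 with rfl | hb0
  · rw [diffCount_zero hF h2 hd hd0 hde]
    simp [zeroWeight, h4]
  rcases quadraticChar_dichotomy hb0 with hb | hb
  · exact square b hb
  · have := square (-b) (by rw [quadraticChar_neg_eq_neg hm, hb, neg_neg])
    rw [diffCount_neg hde, neg_neg] at this
    rw [this, add_comm]

lemma diffCount_le_three (hF : ringChar F ≠ 2) (hm : quadraticChar F (-1) = -1)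
    (h2 : (2 : F) ≠ 0) {d : ℕ} (hd : d + 1 = Fintype.card F / 2) (hd0 : d ≠ 0) (hde : Even d)
    (b : F) : diffCount F d b ≤ 3 := by
  rcases eq_or_ne b 0 with rfl | hb0
  · simp [diffCount_zero hF h2 hd hd0 hde]
  rcases quadraticChar_dichotomy hb0 with hb | hb
  · rw [diffCount_eq hF hm h2 hd hd0 hb]
    split_ifs <;> norm_num
  · rw [← diffCount_neg hde, diffCount_eq hF hm h2 hd hd0
      (by rw [quadraticChar_neg_eq_neg hm, hb, neg_neg])]
    split_ifs <;> norm_num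

lemma diffCount_eq_three_iff (hF : ringChar F ≠ 2) (hm : quadraticChar F (-1) = -1)
    (h2 : (2 : F) ≠ 0) {d : ℕ} (hd : d + 1 = Fintype.card F / 2) (hd0 : d ≠ 0) (hde : Even d)
    (h5 : quadraticChar F 5 = 1) (b : F) : diffCount F d b = 3 ↔ b = 1 ∨ b = -1 := by
  have hone : diffCount F d 1 = 3 := by
    rw [diffCount_eq hF hm h2 hd hd0 (map_one _)]
    norm_num [h5]
  have square : ∀ b : F, quadraticChar F b = 1 → diffCount F d b = 3 → b = 1 := by
    intro b hb h
    rw [diffCount_eq hF hm h2 hd hd0 hb] at h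
    by_contra h1
    rw [if_neg h1] at h
    split_ifs at h <;> norm_num at h
  constructor
  · intro h
    have hb0 : b ≠ 0 := by
      rintro rfl
      simp [diffCount_zero hF h2 hd hd0 hde] at h
    rcases quadraticChar_dichotomy hb0 with hb | hb
    · exact .inl (square b hb h)
    · refine .inr (neg_eq_iff_eq_neg.1 (square (-b) ?_ ?_))
      · rw [quadraticChar_neg_eq_neg hm, hb, neg_neg]
      · rwa [diffCount_neg hde]
  · rintro (rfl | rfl)
    · exact hone
    · rw [diffCount_neg hde, hone]

end QuadraticCharacter

theorem stmt_16 (F : Type*) [Field F] [Fintype F] [DecidableEq F]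
    (hq3 : Fintype.card F % 4 = 3) (hq : 7 < Fintype.card F)
    (d : ℕ) (hd : d = (Fintype.card F - 3) / 2)
    (h5 : (5 : F) ≠ 0) (h5sq : IsSquare (5 : F))
    (lam : ℤ)
    (hlam : lam = (∑ x : F, quadraticChar F (x * (x ^ 2 + 4 * x - 1))) +
        ∑ x : F, quadraticChar F (x * (x ^ 2 - 2 * x + 5)))
    (ω : ℕ → ℕ)
    (hω : ∀ i, ω i = {b : F | {x : F | (x + 1) ^ d - x ^ d = b}.ncard = i}.ncard) :
    4 * (ω 0 : ℤ) = (Fintype.card F : ℤ) + lam + 1 ∧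
    2 * (ω 1 : ℤ) = (Fintype.card F : ℤ) - lam + 3 ∧
    4 * (ω 2 : ℤ) = (Fintype.card F : ℤ) + lam - 15 ∧
    ω 3 = 2 := by
  have hF : ringChar F ≠ 2 := by
    intro h
    have := FiniteField.even_card_iff_char_two.1 h
    omega
  have h2 : (2 : F) ≠ 0 := Ring.two_ne_zero hF
  have hm : quadraticChar F (-1) = -1 := by
    rw [quadraticChar_neg_one_iff_not_isSquare, FiniteField.isSquare_neg_one_iff]
    omega
  have hd1 : d + 1 = Fintype.card F / 2 := by omega
  have hd0 : d ≠ 0 := by omega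
  have hde : Even d := by
    rw [Nat.even_iff]
    omega
  have h5' : quadraticChar F 5 = 1 := (quadraticChar_one_iff_isSquare h5).2 h5sq
  have hcard : ∀ i, ω i = #{b : F | diffCount F d b = i} := by
    intro i
    rw [hω, ← Set.ncard_coe_finset]
    congr 1
    ext b
    simp [diffCount, ← Set.ncard_coe_finset]
  have hsum : ∀ i, (ω i : ℤ) = ∑ b : F, if diffCount F d b = i then 1 else 0 := by
    intro i
    rw [hcard, sum_boole]
  have hthree : ω 3 = 2 := by
    rw [hcard]
    simp only [diffCount_eq_three_iff hF hm h2 hd1 hd0 hde h5']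
    rw [filter_or, filter_eq', filter_eq', if_pos (mem_univ _), if_pos (mem_univ _)]
    exact card_pair (Ring.neg_one_ne_one_of_char_ne_two hF).symm
  have hzero : 8 * (ω 0 : ℤ) = 2 * (Fintype.card F + lam + 1) := by
    rw [hsum, mul_sum,
      sum_congr rfl fun b _ => eight_mul_ite_diffCount hF hm h2 hd1 hd0 hde h5' b,
      sum_add_distrib, show ∑ b : F, zeroWeight (-b) = ∑ b, zeroWeight b from
        Equiv.sum_comp (Equiv.neg F) zeroWeight, sum_zeroWeight hF hm h2, hlam]
    ring
  have htotal : (ω 0 : ℤ) + ω 1 + ω 2 + ω 3 = Fintype.card F := by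
    simp only [hsum, ← sum_add_distrib]
    rw [sum_congr rfl (g := fun _ => (1 : ℤ))]
    · simp
    · intro b _
      have := diffCount_le_three hF hm h2 hd1 hd0 hde b
      interval_cases diffCount F d b <;> simp
  have hweighted : (ω 1 : ℤ) + 2 * ω 2 + 3 * ω 3 = Fintype.card F := by
    rw [← sum_diffCount (F := F) d]
    push_cast
    simp only [hsum, mul_sum, ← sum_add_distrib]
    refine sum_congr rfl fun b _ => ?_
    have := diffCount_le_three hF hm h2 hd1 hd0 hde b
    interval_cases diffCount F d b <;> simp
  rw [hthree] at htotal hweighted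
  push_cast at htotal hweighted
  exact ⟨by linarith, by linarith, by linarith, hthree⟩
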